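/- arXiv:1905.06084 — 2 statements merged into one kernel-verified Lean document; each statement's English description precedes it below -/
import Mathlib

section
/- For every constant δ > 0, every instance of the restricted max-min allocation problem, and every target T > 0, if the configuration LP CLP(T) is feasible, then there exists an allocation (D_p)_{p∈P} such that every player p receives resources of total value Σ_{r∈D_p} v_r ≥ T/(4+δ). (This is the existence content of the paper's (4+δ)-approximation theorem; the polynomial running-time claim is omitted.) -/
/-- The configuration LP `CLP(T)` of an instance of the restricted max-min
allocation problem (players `P`, resources `R`, values `v`, desired sets
`Rp`) is feasible: there are nonnegative reals `x p C`, supported on the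
configurations of `p` (subsets `C ⊆ Rp p` with `Σ_{r∈C} v r ≥ T`), such that
every player receives at least one unit of configurations and every resource
is used in at most one unit of configurations. -/
def CLPFeasible {P R : Type*} [Fintype P] [Fintype R] [DecidableEq R]
    (v : R → ℝ) (Rp : P → Finset R) (T : ℝ) : Prop :=
  ∃ x : P → Finset R → ℝ,
    (∀ p C, 0 ≤ x p C) ∧
    (∀ p C, x p C ≠ 0 → C ⊆ Rp p ∧ T ≤ ∑ r ∈ C, v r) ∧
    (∀ p, 1 ≤ ∑ C : Finset R, x p C) ∧
    (∀ r : R, ∑ p : P, ∑ C ∈ Finset.univ.filter (fun C : Finset R => r ∈ C), x p C ≤ 1)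

open Classical in
/-- The players whose bundle in `M` meets `a`. -/
noncomputable def blockers {P R : Type*} [Fintype P] (M : P → Finset R) (a : Finset R) :
    Finset P :=
  Finset.univ.filter fun q => ¬ Disjoint (M q) a

/-- `e` is an inclusion-minimal subset of `S` of value at least `τ`. -/
structure IsMinBundle {R : Type*} [DecidableEq R] (v : R → ℝ) (S : Finset R) (τ : ℝ)
    (e : Finset R) : Prop where
  subset : e ⊆ S
  le_sum : τ ≤ ∑ r ∈ e, v r
  erase_lt : ∀ r ∈ e, ∑ s ∈ e.erase r, v s < τ

/-- `M` assigns pairwise disjoint minimal bundles to the players in `Q`, and nothing to the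
others. -/
structure IsBundleMatching {P R : Type*} [DecidableEq R] (v : R → ℝ) (Rp : P → Finset R) (τ : ℝ)
    (M : P → Finset R) (Q : Finset P) : Prop where
  disjoint : ∀ p q, p ≠ q → Disjoint (M p) (M q)
  bundle : ∀ p ∈ Q, IsMinBundle v (Rp p) τ (M p)
  eq_empty : ∀ p, p ∉ Q → M p = ∅

/-- An alternating tree rooted at `p₀`: bundles `a i` for `i < k`, where `a i` is a minimal bundle
for `o i`, which is the root or a player blocking an earlier bundle, and `a i` is disjoint from
all earlier bundles and from the bundles in `M` that block them. -/
structure IsAlternatingTree {P R : Type*} [Fintype P] [DecidableEq R] (v : R → ℝ)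
    (Rp : P → Finset R) (τ : ℝ) (M : P → Finset R) (p₀ : P) (k : ℕ) (a : ℕ → Finset R)
    (o : ℕ → P) : Prop where
  bundle : ∀ i < k, IsMinBundle v (Rp (o i)) τ (a i)
  owner : ∀ i < k, o i = p₀ ∨ ∃ j < i, o i ∈ blockers M (a j)
  disjoint : ∀ i j, i < j → j < k → Disjoint (a i) (a j)
  disjoint_blocker : ∀ i j, i < j → j < k → ∀ q ∈ blockers M (a i), Disjoint (M q) (a j)

/-- The lexicographic potential of an alternating tree: the numbers of blockers of its bundles,
padded by a value exceeding all of them. -/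
noncomputable def signature {P R : Type*} [Fintype P] (N : ℕ) (M : P → Finset R) (k : ℕ)
    (a : ℕ → Finset R) : Lex (Fin N → ℕ) :=
  toLex fun i => if (i : ℕ) < k then (blockers M (a i)).card else Fintype.card P + 1

theorem mem_blockers {P R : Type*} [Fintype P] {M : P → Finset R} {a : Finset R} {q : P} :
    q ∈ blockers M a ↔ ¬ Disjoint (M q) a := by
  simp [blockers]

theorem signature_lt {P R : Type*} [Fintype P] {N : ℕ} {M M' : P → Finset R} {k k' : ℕ}
    {a a' : ℕ → Finset R} (j : ℕ) (hjN : j < N) (hjk' : j < k') (hjk : j ≤ k)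
    (heq : ∀ l < j, blockers M' (a' l) = blockers M (a l))
    (hlt : j < k → (blockers M' (a' j)).card < (blockers M (a j)).card) :
    signature N M' k' a' < signature N M k a := by
  refine ⟨⟨j, hjN⟩, fun l hl => ?_, ?_⟩
  · have hl' : (l : ℕ) < j := hl
    simp [signature, heq l hl', hl'.trans hjk', hl'.trans_le hjk]
  · rcases hjk.lt_or_eq with h | h
    · simpa [signature, h, hjk'] using hlt h
    · subst h
      simpa [signature, hjk'] using Nat.lt_succ_of_le (Finset.card_le_univ (blockers M' (a' j)))

theorem exists_isMinBundle {R : Type*} [DecidableEq R] {v : R → ℝ} {τ : ℝ} {S : Finset R}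
    (h : τ ≤ ∑ r ∈ S, v r) : ∃ e, IsMinBundle v S τ e := by
  obtain ⟨e, he, hmin⟩ := (S.powerset.filter fun e => τ ≤ ∑ r ∈ e, v r).exists_min_image
    Finset.card ⟨S, by simpa using h⟩
  simp only [Finset.mem_filter, Finset.mem_powerset] at he hmin
  refine ⟨e, he.1, he.2, fun r hr => ?_⟩
  by_contra! hle
  have := hmin (e.erase r) ⟨(Finset.erase_subset _ _).trans he.1, hle⟩
  have := Finset.card_erase_lt_of_mem hr
  omega

namespace IsMinBundle

variable {R : Type*} [DecidableEq R] {v : R → ℝ} {S : Finset R} {τ : ℝ} {e : Finset R}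

theorem mono {S' : Finset R} (h : IsMinBundle v S τ e) (hS : S ⊆ S') : IsMinBundle v S' τ e :=
  ⟨h.subset.trans hS, h.le_sum, h.erase_lt⟩

theorem eq_singleton (h : IsMinBundle v S τ e) (hv : ∀ r, 0 ≤ v r) {r : R} (hr : r ∈ e)
    (hfat : τ ≤ v r) : e = {r} := by
  refine Finset.eq_singleton_iff_unique_mem.2 ⟨hr, fun s hs => ?_⟩
  by_contra hne
  have h1 := h.erase_lt s hs
  have h2 := Finset.single_le_sum (f := v) (fun t _ => hv t)
    (Finset.mem_erase.2 ⟨Ne.symm hne, hr⟩)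
  linarith

end IsMinBundle

theorem Finset.sum_biUnion_le_of_nonneg {ι R : Type*} [DecidableEq R] {f : R → ℝ}
    (hf : ∀ r, 0 ≤ f r) (s : Finset ι) (t : ι → Finset R) :
    ∑ r ∈ s.biUnion t, f r ≤ ∑ i ∈ s, ∑ r ∈ t i, f r := by
  classical
  induction s using Finset.induction_on with
  | empty => simp
  | insert i s hi ih =>
    rw [Finset.biUnion_insert, Finset.sum_insert hi]
    have h1 := Finset.sum_union_inter (s₁ := t i) (s₂ := s.biUnion t) (f := f)
    have h2 := Finset.sum_nonneg fun r (_ : r ∈ t i ∩ s.biUnion t) => hf r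
    linarith

/-- Weights of resources in the dual solution: a resource worth at least `τ` weighs `3 * τ`, and
any other one weighs its value. -/
noncomputable def dualWeight {R : Type*} (v : R → ℝ) (τ : ℝ) (r : R) : ℝ :=
  open Classical in if τ ≤ v r then 3 * τ else v r

theorem dualWeight_nonneg {R : Type*} {v : R → ℝ} (hv : ∀ r, 0 ≤ v r) {τ : ℝ} (hτ : 0 < τ)
    (r : R) : 0 ≤ dualWeight v τ r := by
  unfold dualWeight
  split_ifs
  · positivity
  · exact hv r

theorem le_sum_dualWeight {R : Type*} {v : R → ℝ} (hv : ∀ r, 0 ≤ v r) {τ : ℝ}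
    (hτ : 0 < τ) {C : Finset R} (hC : 3 * τ ≤ ∑ r ∈ C, v r) :
    3 * τ ≤ ∑ r ∈ C, dualWeight v τ r := by
  by_cases hfat : ∃ r ∈ C, τ ≤ v r
  · obtain ⟨r, hr, hle⟩ := hfat
    have := Finset.single_le_sum (f := dualWeight v τ) (fun t _ => dualWeight_nonneg hv hτ t) hr
    rwa [dualWeight, if_pos hle] at this
  · push Not at hfat
    refine hC.trans_eq (Finset.sum_congr rfl fun r hr => ?_)
    rw [dualWeight, if_neg (hfat r hr).not_ge]

section

variable {P R : Type*} [Fintype P] [DecidableEq R] {v : R → ℝ} {Rp : P → Finset R} {τ : ℝ}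
  {M : P → Finset R} {Q : Finset P} {p₀ : P} {k : ℕ} {a : ℕ → Finset R} {o : ℕ → P}

theorem IsBundleMatching.mem_of_mem_blockers (hM : IsBundleMatching v Rp τ M Q) {q : P}
    {e : Finset R} (hq : q ∈ blockers M e) : q ∈ Q := by
  by_contra h
  simp [mem_blockers, hM.eq_empty q h] at hq

open Classical in
/-- A bundle with at least one blocker, together with all bundles blocking it, has dual weight at
most `3 * τ` per blocker. -/
theorem IsBundleMatching.sum_dualWeight_le (hM : IsBundleMatching v Rp τ M Q)
    (hv : ∀ r, 0 ≤ v r) (hτ : 0 < τ) {S e : Finset R} (he : IsMinBundle v S τ e)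
    (hne : (blockers M e).Nonempty) :
    ∑ r ∈ e ∪ (blockers M e).biUnion M, dualWeight v τ r ≤ 3 * τ * (blockers M e).card := by
  have hcard : (1 : ℝ) ≤ (blockers M e).card := by exact_mod_cast hne.card_pos
  by_cases hfat : ∃ r ∈ e, τ ≤ v r
  · obtain ⟨r, hr, hle⟩ := hfat
    have her := he.eq_singleton hv hr hle
    have hsub : e ∪ (blockers M e).biUnion M ⊆ {r} := by
      refine Finset.union_subset her.subset (Finset.biUnion_subset.2 fun q hq => ?_)
      have hrq : r ∈ M q := by
        have := mem_blockers.1 hq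
        rw [her, Finset.disjoint_singleton_right, not_not] at this
        exact this
      exact ((hM.bundle q (hM.mem_of_mem_blockers hq)).eq_singleton hv hrq hle).subset
    calc ∑ r ∈ e ∪ (blockers M e).biUnion M, dualWeight v τ r
        ≤ ∑ r ∈ {r}, dualWeight v τ r :=
          Finset.sum_le_sum_of_subset_of_nonneg hsub fun t _ _ => dualWeight_nonneg hv hτ t
      _ = 3 * τ := by rw [Finset.sum_singleton, dualWeight, if_pos hle]
      _ ≤ _ := by nlinarith
  · push Not at hfat
    have hthin : ∀ q ∈ blockers M e, ∑ r ∈ M q, dualWeight v τ r ≤ 2 * τ := by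
      intro q hq
      obtain ⟨s, hsq, hse⟩ := Finset.not_disjoint_iff.1 (mem_blockers.1 hq)
      have hb := hM.bundle q (hM.mem_of_mem_blockers hq)
      have hlt : ∀ r ∈ M q, v r < τ := by
        intro r hr
        by_contra! hle
        have := hb.eq_singleton hv hr hle
        rw [this, Finset.mem_singleton] at hsq
        subst hsq
        exact (hfat s hse).not_ge hle
      have h1 : ∑ r ∈ M q, dualWeight v τ r = ∑ r ∈ M q, v r :=
        Finset.sum_congr rfl fun r hr => by rw [dualWeight, if_neg (hlt r hr).not_ge]
      rw [h1, ← Finset.add_sum_erase _ _ hsq]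
      linarith [hb.erase_lt s hsq, hlt s hsq]
    obtain ⟨q, hq⟩ := hne
    obtain ⟨s, hsq, hse⟩ := Finset.not_disjoint_iff.1 (mem_blockers.1 hq)
    have hsub : e ∪ (blockers M e).biUnion M ⊆ e.erase s ∪ (blockers M e).biUnion M := by
      intro r hr
      rcases Finset.mem_union.1 hr with h | h
      · by_cases hrs : r = s
        · subst hrs
          exact Finset.mem_union_right _ (Finset.mem_biUnion.2 ⟨q, hq, hsq⟩)
        · exact Finset.mem_union_left _ (Finset.mem_erase.2 ⟨hrs, h⟩)
      · exact Finset.mem_union_right _ h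
    have hw := dualWeight_nonneg hv hτ
    have h1 : ∑ r ∈ e.erase s, dualWeight v τ r = ∑ r ∈ e.erase s, v r :=
      Finset.sum_congr rfl fun r hr => by
        rw [dualWeight, if_neg (hfat r (Finset.mem_of_mem_erase hr)).not_ge]
    have h2 : ∑ r ∈ (blockers M e).biUnion M, dualWeight v τ r
        ≤ ∑ q ∈ blockers M e, ∑ r ∈ M q, dualWeight v τ r :=
      (Finset.sum_biUnion fun p _ q _ hpq => hM.disjoint p q hpq).le
    have h3 := Finset.sum_le_card_nsmul _ _ _ hthin
    rw [nsmul_eq_mul] at h3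
    have h4 := Finset.sum_union_inter (s₁ := e.erase s) (s₂ := (blockers M e).biUnion M)
      (f := dualWeight v τ)
    have h5 := Finset.sum_nonneg fun r (_ : r ∈ e.erase s ∩ (blockers M e).biUnion M) => hw r
    have h6 := Finset.sum_le_sum_of_subset_of_nonneg hsub fun t _ _ => hw t
    have h7 := he.erase_lt s hse
    nlinarith

/-- If some bundle of an alternating tree has no blockers, then giving it to its owner either
matches the root or decreases the signature. -/
theorem IsAlternatingTree.swap (hM : IsBundleMatching v Rp τ M Q)
    (ht : IsAlternatingTree v Rp τ M p₀ k a o) {N : ℕ} (hkN : k ≤ N) {i : ℕ} (hi : i < k)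
    (hempty : blockers M (a i) = ∅) :
    (∃ M', open Classical in IsBundleMatching v Rp τ M' (insert p₀ Q)) ∨
    ∃ M' k', IsBundleMatching v Rp τ M' Q ∧ k' ≤ N ∧ IsAlternatingTree v Rp τ M' p₀ k' a o ∧
      signature N M' k' a < signature N M k a := by
  classical
  have hdisj : ∀ q, Disjoint (M q) (a i) := fun q => by
    by_contra h
    simpa [hempty] using mem_blockers.2 h
  have hupd : ∀ p q, p ≠ q →
      Disjoint (Function.update M (o i) (a i) p) (Function.update M (o i) (a i) q) := by
    intro p q hpq
    by_cases hp : p = o i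
    · subst hp
      rw [Function.update_self, Function.update_of_ne hpq.symm]
      exact (hdisj q).symm
    · by_cases hq : q = o i
      · subst hq
        rw [Function.update_self, Function.update_of_ne hpq]
        exact hdisj p
      · rw [Function.update_of_ne hp, Function.update_of_ne hq]
        exact hM.disjoint p q hpq
  have hbundle : ∀ p, p = o i ∨ p ∈ Q →
      IsMinBundle v (Rp p) τ (Function.update M (o i) (a i) p) := by
    intro p hp
    by_cases h : p = o i
    · subst h
      rw [Function.update_self]
      exact ht.bundle i hi
    · rw [Function.update_of_ne h]
      exact hM.bundle p (hp.resolve_left h)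
  have hnone : ∀ p, p ≠ o i → p ∉ Q → Function.update M (o i) (a i) p = ∅ := by
    intro p h hp
    rw [Function.update_of_ne h]
    exact hM.eq_empty p hp
  rcases ht.owner i hi with hroot | hex
  · refine Or.inl ⟨_, hupd, fun p hp => hbundle p ?_, fun p hp => ?_⟩
    · rw [hroot]
      exact Finset.mem_insert.1 hp
    · rw [Finset.mem_insert, not_or, ← hroot] at hp
      exact hnone p hp.1 hp.2
  · have hji := (Nat.find_spec hex).1
    have hjo := (Nat.find_spec hex).2
    have hmin : ∀ l < Nat.find hex, o i ∉ blockers M (a l) := fun l hl hmem =>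
      Nat.find_min hex hl ⟨hl.trans hji, hmem⟩
    generalize Nat.find hex = j at hji hjo hmin
    have hoQ := hM.mem_of_mem_blockers hjo
    have hblk : ∀ l ≤ j, blockers (Function.update M (o i) (a i)) (a l)
        = (blockers M (a l)).erase (o i) := by
      intro l hl
      ext q
      rw [Finset.mem_erase, mem_blockers, mem_blockers]
      by_cases hq : q = o i
      · subst hq
        simpa using (ht.disjoint l i (hl.trans_lt hji) hi).symm
      · simp [hq]
    have hblk' : ∀ l < j, blockers (Function.update M (o i) (a i)) (a l) = blockers M (a l) :=
      fun l hl => by rw [hblk l hl.le, Finset.erase_eq_of_notMem (hmin l hl)]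
    refine Or.inr ⟨Function.update M (o i) (a i), j + 1, ⟨hupd, fun p hp => hbundle p (Or.inr hp),
      fun p hp => hnone p (fun h => hp (h ▸ hoQ)) hp⟩, by omega, ?_, ?_⟩
    · refine ⟨fun l hl => ht.bundle l (by omega), fun l hl => ?_,
        fun l m hlm hm => ht.disjoint l m hlm (by omega), fun l m hlm hm q hq => ?_⟩
      · refine (ht.owner l (by omega)).imp_right ?_
        rintro ⟨m, hm, hmem⟩
        exact ⟨m, hm, by rwa [hblk' m (by omega)]⟩
      · rw [hblk l (by omega), Finset.mem_erase] at hq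
        rw [Function.update_of_ne hq.1]
        exact ht.disjoint_blocker l m hlm (by omega) q hq.2
    · refine signature_lt j (by omega) (by omega) (by omega) hblk' fun _ => ?_
      rw [hblk j le_rfl]
      exact Finset.card_erase_lt_of_mem hjo

/-- Distinct bundles of an alternating tree have disjoint sets of blockers. -/
theorem IsAlternatingTree.disjoint_blockers (ht : IsAlternatingTree v Rp τ M p₀ k a o) {i j : ℕ}
    (hi : i < k) (hj : j < k) (hij : i ≠ j) :
    Disjoint (blockers M (a i)) (blockers M (a j)) := by
  wlog hlt : i < j generalizing i j
  · exact (this hj hi hij.symm (by omega)).symm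
  · exact Finset.disjoint_left.2 fun q hqi hqj =>
      mem_blockers.1 hqj (ht.disjoint_blocker i j hlt hj q hqi)

/-- An alternating tree all of whose bundles are blocked has at most as many bundles as there are
players. -/
theorem IsAlternatingTree.le_card (ht : IsAlternatingTree v Rp τ M p₀ k a o)
    (hne : ∀ i < k, (blockers M (a i)).Nonempty) : k ≤ Fintype.card P := by
  classical
  have h := Finset.card_biUnion (s := Finset.range k) (t := fun i => blockers M (a i))
    fun i hi j hj hij => ht.disjoint_blockers (Finset.mem_range.1 hi) (Finset.mem_range.1 hj) hij
  have h1 : ∑ _i ∈ Finset.range k, 1 ≤ ∑ i ∈ Finset.range k, (blockers M (a i)).card :=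
    Finset.sum_le_sum fun i hi => (hne i (Finset.mem_range.1 hi)).card_pos
  have h2 := Finset.card_le_univ ((Finset.range k).biUnion fun i => blockers M (a i))
  simp only [Finset.sum_const, Finset.card_range, smul_eq_mul, mul_one] at h1
  omega

/-- Weak duality for the configuration LP. -/
theorem CLPFeasible.sum_le_sum [Fintype R] {T : ℝ} (h : CLPFeasible v Rp T) (y : P → ℝ)
    (z : R → ℝ) (hy : ∀ p, 0 ≤ y p) (hz : ∀ r, 0 ≤ z r)
    (hyz : ∀ p, ∀ C ⊆ Rp p, T ≤ ∑ r ∈ C, v r → y p ≤ ∑ r ∈ C, z r) :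
    ∑ p, y p ≤ ∑ r, z r := by
  obtain ⟨x, hx0, hxs, hx1, hxr⟩ := h
  calc ∑ p, y p ≤ ∑ p, ∑ C : Finset R, x p C * ∑ r ∈ C, z r := by
        refine Finset.sum_le_sum fun p _ => ?_
        calc y p ≤ (∑ C : Finset R, x p C) * y p := le_mul_of_one_le_left (hy p) (hx1 p)
          _ = ∑ C : Finset R, x p C * y p := Finset.sum_mul ..
          _ ≤ _ := by
            refine Finset.sum_le_sum fun C _ => ?_
            by_cases hC : x p C = 0
            · simp [hC]
            · exact mul_le_mul_of_nonneg_left (hyz p C (hxs p C hC).1 (hxs p C hC).2) (hx0 p C)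
    _ = ∑ r, (∑ p : P, ∑ C ∈ Finset.univ.filter (fun C : Finset R => r ∈ C), x p C) * z r := by
        have hswap : ∀ p, ∑ C : Finset R, x p C * ∑ r ∈ C, z r
            = ∑ r, (∑ C ∈ Finset.univ.filter (fun C : Finset R => r ∈ C), x p C) * z r := by
          intro p
          simp_rw [Finset.mul_sum, Finset.sum_mul]
          exact Finset.sum_comm' (by simp)
        simp_rw [hswap, Finset.sum_mul]
        exact Finset.sum_comm
    _ ≤ ∑ r, z r := Finset.sum_le_sum fun r _ => mul_le_of_le_one_left (hz r) (hxr r)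

/-- If the configuration LP is feasible, an alternating tree all of whose bundles are blocked can
be extended. -/
theorem IsAlternatingTree.exists_addable [Fintype R] (hM : IsBundleMatching v Rp τ M Q)
    (hp₀ : p₀ ∉ Q) (hv : ∀ r, 0 ≤ v r) (hτ : 0 < τ) (hfeas : CLPFeasible v Rp (4 * τ))
    (ht : IsAlternatingTree v Rp τ M p₀ k a o) (hne : ∀ i < k, (blockers M (a i)).Nonempty) :
    ∃ p e, IsMinBundle v (Rp p) τ e ∧ (p = p₀ ∨ ∃ j < k, p ∈ blockers M (a j)) ∧
      ∀ i < k, Disjoint (a i) e ∧ ∀ q ∈ blockers M (a i), Disjoint (M q) e := by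
  classical
  set A : Finset P := (Finset.range k).biUnion fun i => blockers M (a i) with hA
  set X : Finset R := (Finset.range k).biUnion fun i => a i ∪ (blockers M (a i)).biUnion M with hX
  have hw := dualWeight_nonneg hv hτ
  by_contra! hstuck
  have hsmall : ∀ p ∈ insert p₀ A, ∑ r ∈ Rp p \ X, v r < τ := by
    intro p hp
    by_contra! hle
    obtain ⟨e, he⟩ := exists_isMinBundle hle
    have hdisj : Disjoint X e := Finset.disjoint_of_subset_right he.subset Finset.disjoint_sdiff
    simp only [hX, Finset.disjoint_biUnion_left, Finset.disjoint_union_left,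
      Finset.mem_range] at hdisj
    obtain ⟨i, hi, h⟩ := hstuck p e (he.mono Finset.sdiff_subset) (by simpa [hA] using hp)
    obtain ⟨q, hq, hqe⟩ := h (hdisj i hi).1
    exact hqe ((hdisj i hi).2 q hq)
  have hdual := hfeas.sum_le_sum (fun p => if p ∈ insert p₀ A then 3 * τ else 0)
    (fun r => if r ∈ X then dualWeight v τ r else 0)
    (fun p => by positivity) (fun r => by split_ifs <;> simp [hw]) (by
      intro p C hC hval
      rw [Finset.sum_ite_mem]
      split_ifs with hp
      · refine le_sum_dualWeight hv hτ ?_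
        have h1 := Finset.sum_inter_add_sum_sdiff C X v
        have h2 := Finset.sum_le_sum_of_subset_of_nonneg (Finset.sdiff_subset_sdiff hC subset_rfl)
          fun r (_ : r ∈ Rp p \ X) (_ : r ∉ C \ X) => hv r
        linarith [hsmall p hp]
      · exact Finset.sum_nonneg fun r _ => hw r)
  rw [Finset.sum_ite_mem, Finset.sum_ite_mem, Finset.univ_inter, Finset.univ_inter,
    Finset.sum_const, nsmul_eq_mul] at hdual
  have hcardA : A.card = ∑ i ∈ Finset.range k, (blockers M (a i)).card :=
    Finset.card_biUnion fun i hi j hj hij =>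
      ht.disjoint_blockers (Finset.mem_range.1 hi) (Finset.mem_range.1 hj) hij
  have hp₀A : p₀ ∉ A := by
    intro h
    obtain ⟨i, -, hi⟩ := Finset.mem_biUnion.1 h
    exact hp₀ (hM.mem_of_mem_blockers hi)
  have hXle : ∑ r ∈ X, dualWeight v τ r ≤ 3 * τ * A.card := by
    rw [hcardA, Nat.cast_sum, Finset.mul_sum]
    refine (Finset.sum_biUnion_le_of_nonneg hw _ _).trans (Finset.sum_le_sum fun i hi => ?_)
    have hi := Finset.mem_range.1 hi
    exact hM.sum_dualWeight_le hv hτ (ht.bundle i hi) (hne i hi)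
  rw [Finset.card_insert_of_notMem hp₀A] at hdual
  push_cast at hdual
  nlinarith

/-- Appending an addable bundle to an alternating tree. -/
theorem IsAlternatingTree.append (ht : IsAlternatingTree v Rp τ M p₀ k a o) {p : P}
    {e : Finset R} (he : IsMinBundle v (Rp p) τ e)
    (hp : p = p₀ ∨ ∃ j < k, p ∈ blockers M (a j))
    (hdisj : ∀ i < k, Disjoint (a i) e ∧ ∀ q ∈ blockers M (a i), Disjoint (M q) e) :
    IsAlternatingTree v Rp τ M p₀ (k + 1) (Function.update a k e) (Function.update o k p) := by
  have hcase : ∀ i < k + 1, i < k ∨ i = k := fun i hi => by omega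
  refine ⟨fun i hi => ?_, fun i hi => ?_, fun i j hij hj => ?_, fun i j hij hj => ?_⟩
  · rcases hcase i hi with h | rfl
    · simpa [Function.update_of_ne h.ne] using ht.bundle i h
    · simpa using he
  · rcases hcase i hi with h | rfl
    · rw [Function.update_of_ne h.ne]
      refine (ht.owner i h).imp_right ?_
      rintro ⟨j, hj, hmem⟩
      exact ⟨j, hj, by rwa [Function.update_of_ne (hj.trans h).ne]⟩
    · rw [Function.update_self]
      refine hp.imp_right ?_
      rintro ⟨j, hj, hmem⟩
      exact ⟨j, hj, by rwa [Function.update_of_ne hj.ne]⟩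
  · have hik : i < k := by omega
    rw [Function.update_of_ne hik.ne]
    rcases hcase j hj with h | rfl
    · simpa [Function.update_of_ne h.ne] using ht.disjoint i j hij h
    · simpa using (hdisj i hik).1
  · have hik : i < k := by omega
    rw [Function.update_of_ne hik.ne]
    rcases hcase j hj with h | rfl
    · simpa [Function.update_of_ne h.ne] using ht.disjoint_blocker i j hij h
    · simpa using (hdisj i hik).2

/-- If the configuration LP is feasible, every bundle matching can be extended to cover one more
player. -/
theorem IsBundleMatching.exists_insert [Fintype R] (hM : IsBundleMatching v Rp τ M Q)
    (hp₀ : p₀ ∉ Q) (hv : ∀ r, 0 ≤ v r) (hτ : 0 < τ) (hfeas : CLPFeasible v Rp (4 * τ)) :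
    ∃ M', open Classical in IsBundleMatching v Rp τ M' (insert p₀ Q) := by
  classical
  by_contra hno
  set N := Fintype.card P + 1 with hN
  suffices H : ∀ s : Lex (Fin N → ℕ), ∀ M k a o, IsBundleMatching v Rp τ M Q → k ≤ N →
      IsAlternatingTree v Rp τ M p₀ k a o → signature N M k a ≠ s from
    H _ M 0 (fun _ => ∅) (fun _ => p₀) hM (by omega)
      ⟨by simp, by simp, by simp, by simp⟩ rfl
  intro s
  induction s using WellFoundedLT.induction with
  | ind s ih =>
    rintro M k a o hM hk ht rfl
    by_cases hne : ∀ i < k, (blockers M (a i)).Nonempty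
    · obtain ⟨p, e, he, hp, hdisj⟩ := ht.exists_addable hM hp₀ hv hτ hfeas hne
      have hkN := ht.le_card hne
      refine ih _ ?_ M (k + 1) _ _ hM (by omega) (ht.append he hp hdisj) rfl
      refine signature_lt k (by omega) (by omega) le_rfl (fun l hl => ?_) fun h => absurd h (by simp)
      rw [Function.update_of_ne hl.ne]
    · push Not at hne
      obtain ⟨i, hi, hempty⟩ := hne
      obtain h | ⟨M', k', hM', hk', htree, hlt⟩ := ht.swap hM hk hi hempty
      · exact hno h
      · exact ih _ hlt M' k' a o hM' hk' htree rfl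

end

/-- **Existence content of the `(4+δ)`-approximation theorem.**  For every
`δ > 0`, every instance of the restricted max-min allocation problem and
every target `T > 0`, if `CLP(T)` is feasible then there is an allocation
`(D p)_{p ∈ P}` (pairwise disjoint sets of desired resources) in which every
player receives at least `T/(4+δ)` worth of resources. -/
theorem four_plus_delta_approx {P R : Type*} [Fintype P] [Fintype R] [DecidableEq R]
    (delta : ℝ) (hdelta : 0 < delta)
    (v : R → ℝ) (hv : ∀ r, 0 ≤ v r) (Rp : P → Finset R)
    (T : ℝ) (hT : 0 < T) (hfeas : CLPFeasible v Rp T) :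
    ∃ D : P → Finset R,
      (∀ p, D p ⊆ Rp p) ∧
      (∀ p q, p ≠ q → Disjoint (D p) (D q)) ∧
      (∀ p, T / (4 + delta) ≤ ∑ r ∈ D p, v r) := by
  classical
  have hτ : 0 < T / 4 := by positivity
  have hfeas' : CLPFeasible v Rp (4 * (T / 4)) := by
    rwa [mul_div_cancel₀ T (by norm_num : (4 : ℝ) ≠ 0)]
  have hmatch : ∀ Q : Finset P, ∃ M, IsBundleMatching v Rp (T / 4) M Q := by
    intro Q
    induction Q using Finset.induction_on with
    | empty => exact ⟨fun _ => ∅, by simp, by simp, by simp⟩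
    | insert p Q hp ih =>
      obtain ⟨M, hM⟩ := ih
      obtain ⟨M', hM'⟩ := hM.exists_insert hp hv hτ hfeas'
      exact ⟨M', by convert hM'⟩
  obtain ⟨M, hM⟩ := hmatch Finset.univ
  refine ⟨M, fun p => (hM.bundle p (Finset.mem_univ p)).subset, hM.disjoint, fun p => ?_⟩
  refine le_trans ?_ (hM.bundle p (Finset.mem_univ p)).le_sum
  exact div_le_div_of_nonneg_left hT.le (by norm_num) (by linarith)
end

section
/- Let G be a bipartite graph with vertex classes P (players) and F (resources), let M be a maximum matching of G, let S be a set of players not matched by M, let T be a set of players, and let Π be a feasible solution for G_M(S,T). Then M ⊕ Π is a maximum matching of G, and Π is an optimal solution for G_M(S,T) (i.e., |Π| = f_M(S,T)) if and only if there is no directed path in G_{M⊕Π} from a vertex of S ∖ src_Π to a vertex of T ∖ sink_Π (where a single vertex lying in both S ∖ src_Π and T ∖ sink_Π counts as such a path). -/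
section Framework

variable {P F : Type*} [Fintype P] [Fintype F] [DecidableEq P] [DecidableEq F]

/-- A matching of the bipartite graph with edge relation `E`: a set of
player–resource pairs that are edges, no two sharing a player or a resource. -/
def IsMatching (E : P → F → Prop) (M : Finset (P × F)) : Prop :=
  (∀ e ∈ M, E e.1 e.2) ∧
  (∀ e ∈ M, ∀ e' ∈ M, e.1 = e'.1 → e = e') ∧
  (∀ e ∈ M, ∀ e' ∈ M, e.2 = e'.2 → e = e')

/-- A maximum matching of the bipartite graph with edge relation `E`. -/
def IsMaxMatching (E : P → F → Prop) (M : Finset (P × F)) : Prop :=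
  IsMatching E M ∧ ∀ M' : Finset (P × F), IsMatching E M' → M'.card ≤ M.card

/-- The directed graph `G_M`: each edge `{p, r}` of `G` is oriented from the
resource `r` to the player `p` if `{p, r} ∈ M`, and from `p` to `r` otherwise. -/
def DirAdj (E : P → F → Prop) (M : Finset (P × F)) : P ⊕ F → P ⊕ F → Prop :=
  fun x y => match x, y with
  | Sum.inl p, Sum.inr r => E p r ∧ (p, r) ∉ M
  | Sum.inr r, Sum.inl p => (p, r) ∈ M
  | _, _ => False

/-- A (simple) directed path in the digraph with adjacency `A`, recorded as
its nonempty, duplicate-free list of vertices.  A one-vertex list is a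
trivial path. -/
def IsDirPath (A : P ⊕ F → P ⊕ F → Prop) (l : List (P ⊕ F)) : Prop :=
  l ≠ [] ∧ l.Chain' A ∧ l.Nodup

/-- The path `l` starts at a player belonging to `S`. -/
def startsIn (S : Set P) (l : List (P ⊕ F)) : Prop :=
  ∃ p ∈ S, l.head? = some (Sum.inl p)

/-- The path `l` ends at a player belonging to `T`. -/
def endsIn (T : Set P) (l : List (P ⊕ F)) : Prop :=
  ∃ q ∈ T, l.getLast? = some (Sum.inl q)

/-- A feasible solution for `G_M(S,T)`: a set of pairwise vertex-disjoint
directed paths in `G_M`, each starting at a vertex of `S` and ending at a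
vertex of `T` (single-vertex paths at vertices of `S ∩ T` are allowed). -/
def Feasible (E : P → F → Prop) (M : Finset (P × F)) (S T : Set P)
    (Ps : Finset (List (P ⊕ F))) : Prop :=
  (∀ l ∈ Ps, IsDirPath (DirAdj E M) l) ∧
  (∀ l ∈ Ps, startsIn S l) ∧
  (∀ l ∈ Ps, endsIn T l) ∧
  (∀ l ∈ Ps, ∀ l' ∈ Ps, l ≠ l' → ∀ x, x ∈ l → x ∉ l')

/-- `f_M(S,T)`: the maximum number of pairwise vertex-disjoint paths in `G_M`
from `S` to `T`. -/
noncomputable def fM (E : P → F → Prop) (M : Finset (P × F)) (S T : Set P) : ℕ :=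
  sSup {n | ∃ Ps : Finset (List (P ⊕ F)), Feasible E M S T Ps ∧ Ps.card = n}

/-- The sources of a set of paths. -/
def srcOf (Ps : Finset (List (P ⊕ F))) : Set P :=
  {p | ∃ l ∈ Ps, l.head? = some (Sum.inl p)}

/-- The sinks of a set of paths. -/
def sinkOf (Ps : Finset (List (P ⊕ F))) : Set P :=
  {p | ∃ l ∈ Ps, l.getLast? = some (Sum.inl p)}

/-- The path `l` traverses the (undirected) edge `{p, r}`. -/
def usesEdge (l : List (P ⊕ F)) (p : P) (r : F) : Prop :=
  (Sum.inl p, Sum.inr r) ∈ l.zip l.tail ∨ (Sum.inr r, Sum.inl p) ∈ l.zip l.tail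

open Classical in
/-- `M ⊕ Ps`: the symmetric difference of the matching `M` with the set of
(undirected) edges used by the paths of `Ps`. -/
noncomputable def symmDiffMatch (M : Finset (P × F)) (Ps : Finset (List (P ⊕ F))) :
    Finset (P × F) :=
  Finset.univ.filter (fun e : P × F => (∃ l ∈ Ps, usesEdge l e.1 e.2) ↔ e ∉ M)

end Framework

section ListLemmas

variable {α : Type*}

theorem mem_zip_tail_iff {l : List α} {u v : α} :
    (u, v) ∈ l.zip l.tail ↔ ∃ i, l[i]? = some u ∧ l[i + 1]? = some v := by
  simp [List.mem_iff_getElem?, List.getElem?_zip_eq_some]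

theorem eq_or_exists_pred_of_mem {l : List α} {v : α} (h : v ∈ l) :
    l.head? = some v ∨ ∃ u, (u, v) ∈ l.zip l.tail := by
  obtain ⟨i, hi⟩ := List.mem_iff_getElem?.1 h
  cases i with
  | zero => left; rwa [List.head?_eq_getElem?]
  | succ i =>
    right
    have : i < l.length := by grind
    exact ⟨l[i], mem_zip_tail_iff.2 ⟨i, by grind, hi⟩⟩

theorem eq_or_exists_succ_of_mem {l : List α} {v : α} (h : v ∈ l) :
    l.getLast? = some v ∨ ∃ w, (v, w) ∈ l.zip l.tail := by
  obtain ⟨i, hi⟩ := List.mem_iff_getElem?.1 h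
  by_cases hl : i + 1 < l.length
  · exact Or.inr ⟨l[i + 1], mem_zip_tail_iff.2 ⟨i, hi, by grind⟩⟩
  · left
    rw [List.getLast?_eq_getElem?]
    have : l.length - 1 = i := by grind
    rwa [this]

theorem not_getLast_of_mem_zip_tail {l : List α} (hn : l.Nodup) {u v : α}
    (h : (u, v) ∈ l.zip l.tail) : l.getLast? ≠ some u := by
  obtain ⟨i, hi, hj⟩ := mem_zip_tail_iff.1 h
  rw [List.getLast?_eq_getElem?]
  intro hu
  have := (List.getElem?_inj (i := i) (by grind) hn).1 (hi.trans hu.symm)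
  grind

theorem succ_unique_of_nodup {l : List α} (hn : l.Nodup) {u v w : α}
    (h : (u, v) ∈ l.zip l.tail) (h' : (u, w) ∈ l.zip l.tail) : v = w := by
  obtain ⟨i, hi, hj⟩ := mem_zip_tail_iff.1 h
  obtain ⟨i', hi', hj'⟩ := mem_zip_tail_iff.1 h'
  have := (List.getElem?_inj (i := i) (by grind) hn).1 (hi.trans hi'.symm)
  grind

theorem pred_unique_of_nodup {l : List α} (hn : l.Nodup) {u v w : α}
    (h : (u, w) ∈ l.zip l.tail) (h' : (v, w) ∈ l.zip l.tail) : u = v := by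
  obtain ⟨i, hi, hj⟩ := mem_zip_tail_iff.1 h
  obtain ⟨i', hi', hj'⟩ := mem_zip_tail_iff.1 h'
  have := (List.getElem?_inj (i := i + 1) (by grind) hn).1 (hj.trans hj'.symm)
  grind

theorem rel_of_mem_zip_tail {A : α → α → Prop} {l : List α} (hl : l.IsChain A) {u v : α}
    (h : (u, v) ∈ l.zip l.tail) : A u v := by
  obtain ⟨i, hi, hj⟩ := mem_zip_tail_iff.1 h
  have := List.isChain_iff_getElem.1 hl i
  grind

theorem mem_of_mem_zip_tail {l : List α} {u v : α} (h : (u, v) ∈ l.zip l.tail) :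
    u ∈ l ∧ v ∈ l :=
  ⟨(List.of_mem_zip h).1, List.mem_of_mem_tail (List.of_mem_zip h).2⟩

end ListLemmas

section Paths

variable {P F : Type*}

theorem isDirPath_iff {A : P ⊕ F → P ⊕ F → Prop} {l : List (P ⊕ F)} :
    IsDirPath A l ↔ l ≠ [] ∧ l.IsChain A ∧ l.Nodup := Iff.rfl

theorem exists_isDirPath_of_reflTransGen {A : P ⊕ F → P ⊕ F → Prop} {a b : P ⊕ F}
    (h : Relation.ReflTransGen A a b) :
    ∃ l, IsDirPath A l ∧ l.head? = some a ∧ l.getLast? = some b := by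
  simp only [isDirPath_iff]
  induction h with
  | refl => exact ⟨[a], ⟨by simp, List.isChain_singleton a, by simp⟩, by simp, by simp⟩
  | @tail b c _ hbc ih =>
    obtain ⟨l, ⟨hne, hc, hnd⟩, hh, hl⟩ := ih
    by_cases hm : c ∈ l
    · obtain ⟨l₁, l₂, rfl⟩ := List.append_of_mem hm
      have he : l₁ ++ c :: l₂ = (l₁ ++ [c]) ++ l₂ := by simp
      refine ⟨l₁ ++ [c], ⟨by simp, ?_, ?_⟩, ?_, by simp⟩
      · rw [he] at hc
        exact hc.left_of_append
      · rw [he] at hnd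
        exact hnd.of_append_left
      · cases l₁ <;> simpa using hh
    · refine ⟨l ++ [c], ⟨by simp, ?_, ?_⟩, ?_, by simp⟩
      · rw [List.isChain_append]
        refine ⟨hc, by simp, ?_⟩
        intro x hx y hy
        simp_all
      · exact hnd.append (List.nodup_singleton c) (by simpa using hm)
      · cases l <;> simp_all

theorem reflTransGen_of_mem_isDirPath {A : P ⊕ F → P ⊕ F → Prop} {l : List (P ⊕ F)} {a v : P ⊕ F}
    (hl : IsDirPath A l) (ha : l.head? = some a) (hv : v ∈ l) :
    Relation.ReflTransGen A a v := by
  obtain ⟨l, rfl⟩ : ∃ t, l = a :: t := by cases l <;> simp_all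
  have hc : (a :: l).IsChain A := (isDirPath_iff.1 hl).2.1
  exact List.IsChain.induction (Relation.ReflTransGen A a ·) (a :: l) hc
    (fun _ _ h₁ h₂ => h₂.tail h₁) (fun _ => .refl) v hv

end Paths

section Decomposition

variable {P F : Type*} {E : P → F → Prop} {M N : Finset (P × F)}

theorem card_le_card_of_resource_matched [DecidableEq F] (hM : IsMatching E M)
    (h : ∀ r, (∃ p, (p, r) ∈ M) → ∃ p, (p, r) ∈ N) :
    M.card ≤ N.card := by
  have hi : Set.InjOn Prod.snd (M : Set (P × F)) := fun e he e' he' => hM.2.2 e he e' he'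
  rw [← Finset.card_image_of_injOn hi]
  refine (Finset.card_le_card ?_).trans (Finset.card_image_le (s := N) (f := Prod.snd))
  intro r hr
  obtain ⟨⟨p, _⟩, hp, rfl⟩ := Finset.mem_image.1 hr
  obtain ⟨q, hq⟩ := h _ ⟨p, hp⟩
  exact Finset.mem_image.2 ⟨(q, _), hq, rfl⟩

/-- If every resource matched by `N` is matched by `M`, then a set `R` of players that is closed
under following an edge of `N` and then one of `M` contains at least as many players unmatched
by `N` as it contains players from any given set `A` of players unmatched by `M`. -/
theorem card_le_card_unmatched_of_closed [DecidableEq P] (hM : IsMatching E M)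
    (hN : IsMatching E N) (hNM : ∀ r, (∃ p, (p, r) ∈ N) → ∃ p, (p, r) ∈ M)
    {A R B : Finset P} (hA : ∀ p ∈ A, ∀ r, (p, r) ∉ M) (hAR : A ⊆ R)
    (hR : ∀ p ∈ R, ∀ q r, (p, r) ∈ N → (q, r) ∈ M → q ∈ R)
    (hB : ∀ p ∈ R, (∀ r, (p, r) ∉ N) → p ∈ B) : A.card ≤ B.card := by
  classical
  have hstep : ∀ p ∈ R \ B, ∃ q r, (p, r) ∈ N ∧ (q, r) ∈ M := by
    intro p hp
    obtain ⟨hpR, hpB⟩ := Finset.mem_sdiff.1 hp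
    by_contra! hc
    refine hpB (hB p hpR fun r hr => ?_)
    obtain ⟨q, hq⟩ := hNM r ⟨p, hr⟩
    exact hc q r hr hq
  choose g ρ hρN hρM using hstep
  have hcard : (R \ B).card ≤ (R \ A).card := by
    refine Finset.card_le_card_of_injOn (fun p => if h : p ∈ R \ B then g p h else p) ?_ ?_
    · intro p hp
      rw [Finset.mem_coe] at hp
      simp only [hp, dif_pos]
      exact Finset.mem_coe.2 (Finset.mem_sdiff.2
        ⟨hR p (Finset.mem_sdiff.1 hp).1 _ _ (hρN p hp) (hρM p hp),
          fun hg => hA _ hg _ (hρM p hp)⟩)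
    · intro p hp q hq hpq
      rw [Finset.mem_coe] at hp hq
      simp only [hp, hq, dif_pos] at hpq
      have hr : ρ p hp = ρ q hq := congrArg Prod.snd (hM.2.1 _ (hρM p hp) _ (hρM q hq) hpq)
      exact congrArg Prod.fst (hN.2.2 _ (hρN p hp) _ (hρN q hq) hr)
  have h₁ := Finset.card_sdiff_add_card_eq_card hAR
  have h₂ := Finset.card_le_card_sdiff_add_card (s := R) (t := B)
  omega

/-- The arcs of `G_M` that belong to the symmetric difference of `M` and `N`. -/
def AltAdj (M N : Finset (P × F)) : P ⊕ F → P ⊕ F → Prop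
  | Sum.inl p, Sum.inr r => (p, r) ∈ N ∧ (p, r) ∉ M
  | Sum.inr r, Sum.inl p => (p, r) ∈ M ∧ (p, r) ∉ N
  | _, _ => False

theorem AltAdj.dirAdj (hN : IsMatching E N) {u v : P ⊕ F} (h : AltAdj M N u v) :
    DirAdj E M u v := by
  rcases u with p | r <;> rcases v with q | s
  · exact h
  · exact ⟨hN.1 _ h.1, h.2⟩
  · exact h.1
  · exact h

theorem AltAdj.pred_unique (hM : IsMatching E M) (hN : IsMatching E N) {u v w : P ⊕ F}
    (hu : AltAdj M N u w) (hv : AltAdj M N v w) : u = v := by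
  rcases u with p | r <;> rcases v with q | s <;> rcases w with x | y <;>
    first
    | exact hu.elim
    | exact hv.elim
    | skip
  · exact congrArg (Sum.inl ∘ Prod.fst) (hN.2.2 _ hu.1 _ hv.1 rfl)
  · exact congrArg (Sum.inr ∘ Prod.snd) (hM.2.1 _ hu.1 _ hv.1 rfl)

theorem eq_of_reflTransGen_altAdj (hM : IsMatching E M) (hN : IsMatching E N) {p q : P}
    (hp : ∀ r, (p, r) ∉ M) (hq : ∀ r, (q, r) ∉ M) {v : P ⊕ F}
    (hpv : Relation.ReflTransGen (AltAdj M N) (Sum.inl p) v)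
    (hqv : Relation.ReflTransGen (AltAdj M N) (Sum.inl q) v) : p = q := by
  have key {p q : P} (hq : ∀ r, (q, r) ∉ M)
      (h : Relation.ReflTransGen (AltAdj M N) (Sum.inl p) (Sum.inl q)) : p = q := by
    rcases h.cases_tail with h | ⟨u, -, hu⟩
    · exact (Sum.inl_injective h).symm
    · rcases u with x | r
      · exact hu.elim
      · exact (hq r hu.1).elim
  have hU : Relator.RightUnique (Function.swap (AltAdj M N)) :=
    fun _ _ _ hu hv => AltAdj.pred_unique hM hN hu hv
  rcases Relation.ReflTransGen.total_of_right_unique hU hpv.swap hqv.swap with h | h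
  · exact (key hp h.swap).symm
  · exact key hq h.swap

theorem exists_reflTransGen_altAdj [Fintype P] (hM : IsMatching E M) (hN : IsMatching E N)
    (hNM : ∀ r, (∃ p, (p, r) ∈ N) → ∃ p, (p, r) ∈ M) {x : P} (hx : ∀ r, (x, r) ∉ M) {Y : Set P}
    (hxY : x ∈ Y ∨ ∃ r, (x, r) ∈ N) (hY : ∀ p r, (p, r) ∈ M → p ∈ Y ∨ ∃ s, (p, s) ∈ N) :
    ∃ y ∈ Y, Relation.ReflTransGen (AltAdj M N) (Sum.inl x) (Sum.inl y) := by
  classical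
  by_contra! hc
  let R : Finset P :=
    Finset.univ.filter fun p => Relation.ReflTransGen (AltAdj M N) (Sum.inl x) (Sum.inl p)
  have hR {p} : p ∈ R ↔ Relation.ReflTransGen (AltAdj M N) (Sum.inl x) (Sum.inl p) := by
    simp [R]
  have := card_le_card_unmatched_of_closed (A := {x}) (B := ∅) (R := R) hM hN hNM
    (by simpa using hx) (by simpa [hR] using Relation.ReflTransGen.refl) ?_ ?_
  · simp at this
  · intro p hp q r hpr hqr
    by_cases hpq : p = q
    · exact hpq ▸ hp
    · rw [hR] at hp ⊢
      have hp' : AltAdj M N (Sum.inl p) (Sum.inr r) :=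
        ⟨hpr, fun hm => hpq (congrArg Prod.fst (hM.2.2 _ hm _ hqr rfl))⟩
      have hq' : AltAdj M N (Sum.inr r) (Sum.inl q) :=
        ⟨hqr, fun hm => hpq (congrArg Prod.fst (hN.2.2 _ hpr _ hm rfl))⟩
      exact (hp.tail hp').tail hq'
  · intro p hp hn
    have hpY : p ∉ Y := fun hpY => hc p hpY (hR.1 hp)
    have : p ∈ Y ∨ ∃ s, (p, s) ∈ N := by
      rcases (hR.1 hp).cases_tail with h | ⟨u, -, hu⟩
      · obtain rfl := Sum.inl_injective h
        exact hxY
      · rcases u with q | r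
        · exact hu.elim
        · exact hY p r hu.1
    obtain ⟨s, hs⟩ := this.resolve_left hpY
    exact (hn s hs).elim

/-- Two matchings `M` and `N` yield vertex-disjoint paths in `G_M` from a set `X` of players
unmatched by `M` to a set `Y` containing the players matched by `M` or lying in `X` that `N`
leaves unmatched. -/
theorem exists_feasible_card_eq [Fintype P] (hM : IsMatching E M) (hN : IsMatching E N)
    (hNM : ∀ r, (∃ p, (p, r) ∈ N) → ∃ p, (p, r) ∈ M) (X : Finset P) (hX : ∀ p ∈ X, ∀ r, (p, r) ∉ M)
    {Y : Set P} (hXY : ∀ p ∈ X, p ∈ Y ∨ ∃ r, (p, r) ∈ N)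
    (hY : ∀ p r, (p, r) ∈ M → p ∈ Y ∨ ∃ s, (p, s) ∈ N) :
    ∃ Ps, Feasible E M X Y Ps ∧ Ps.card = X.card := by
  classical
  have hpath : ∀ x ∈ X, ∃ l : List (P ⊕ F), IsDirPath (AltAdj M N) l ∧
      l.head? = some (Sum.inl x) ∧ endsIn Y l := by
    intro x hx
    obtain ⟨y, hy, hxy⟩ := exists_reflTransGen_altAdj hM hN hNM (hX x hx) (hXY x hx) hY
    obtain ⟨l, hl, hh, ht⟩ := exists_isDirPath_of_reflTransGen hxy
    exact ⟨l, hl, hh, y, hy, ht⟩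
  choose! π hπ hhead hend using hpath
  have hdisj : ∀ x ∈ X, ∀ y ∈ X, ∀ v, v ∈ π x → v ∈ π y → x = y := fun x hx y hy v hvx hvy =>
    eq_of_reflTransGen_altAdj hM hN (hX x hx) (hX y hy)
      (reflTransGen_of_mem_isDirPath (hπ x hx) (hhead x hx) hvx)
      (reflTransGen_of_mem_isDirPath (hπ y hy) (hhead y hy) hvy)
  refine ⟨X.image π, ⟨?_, ?_, ?_, ?_⟩, Finset.card_image_of_injOn ?_⟩
  · simp only [Finset.forall_mem_image]
    intro x hx
    obtain ⟨h₁, h₂, h₃⟩ := isDirPath_iff.1 (hπ x hx)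
    exact isDirPath_iff.2 ⟨h₁, h₂.imp fun _ _ h => AltAdj.dirAdj hN h, h₃⟩
  · simp only [Finset.forall_mem_image]
    exact fun x hx => ⟨x, hx, hhead x hx⟩
  · simp only [Finset.forall_mem_image]
    exact fun x hx => hend x hx
  · simp only [Finset.forall_mem_image]
    intro x hx y hy hne v hvx hvy
    exact hne (congrArg π (hdisj x hx y hy v hvx hvy))
  · intro x hx y hy hxy
    have := (hhead x hx).symm.trans ((congrArg List.head? hxy).trans (hhead y hy))
    simpa using this

end Decomposition

section Flip

variable {P F : Type*} {E : P → F → Prop} {M : Finset (P × F)} {S T : Set P}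
  {Ps : Finset (List (P ⊕ F))}

/-- `u` is immediately followed by `v` on one of the paths of `Ps`. -/
def Follows (Ps : Finset (List (P ⊕ F))) (u v : P ⊕ F) : Prop :=
  ∃ l ∈ Ps, (u, v) ∈ l.zip l.tail

theorem Feasible.eq_of_mem (h : Feasible E M S T Ps) {l l' : List (P ⊕ F)} (hl : l ∈ Ps)
    (hl' : l' ∈ Ps) {x : P ⊕ F} (hx : x ∈ l) (hx' : x ∈ l') : l = l' := by
  by_contra hne
  exact h.2.2.2 l hl l' hl' hne x hx hx'

theorem Feasible.dirAdj (h : Feasible E M S T Ps) {u v : P ⊕ F} (huv : Follows Ps u v) :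
    DirAdj E M u v := by
  obtain ⟨l, hl, hm⟩ := huv
  exact rel_of_mem_zip_tail (isDirPath_iff.1 (h.1 l hl)).2.1 hm

theorem Feasible.succ_unique (h : Feasible E M S T Ps) {u v w : P ⊕ F} (hv : Follows Ps u v)
    (hw : Follows Ps u w) : v = w := by
  obtain ⟨l, hl, hm⟩ := hv
  obtain ⟨l', hl', hm'⟩ := hw
  obtain rfl := h.eq_of_mem hl hl' (mem_of_mem_zip_tail hm).1 (mem_of_mem_zip_tail hm').1
  exact succ_unique_of_nodup (h.1 l hl).2.2 hm hm'

theorem Feasible.pred_unique (h : Feasible E M S T Ps) {u v w : P ⊕ F} (hu : Follows Ps u w)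
    (hv : Follows Ps v w) : u = v := by
  obtain ⟨l, hl, hm⟩ := hu
  obtain ⟨l', hl', hm'⟩ := hv
  obtain rfl := h.eq_of_mem hl hl' (mem_of_mem_zip_tail hm).2 (mem_of_mem_zip_tail hm').2
  exact pred_unique_of_nodup (h.1 l hl).2.2 hm hm'

theorem srcOf_or_exists_follows {l : List (P ⊕ F)} (hl : l ∈ Ps) {p : P} (hp : Sum.inl p ∈ l) :
    p ∈ srcOf Ps ∨ ∃ u, Follows Ps u (Sum.inl p) := by
  rcases eq_or_exists_pred_of_mem hp with h | ⟨u, hu⟩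
  · exact Or.inl ⟨l, hl, h⟩
  · exact Or.inr ⟨u, l, hl, hu⟩

theorem sinkOf_or_exists_follows {l : List (P ⊕ F)} (hl : l ∈ Ps) {p : P} (hp : Sum.inl p ∈ l) :
    p ∈ sinkOf Ps ∨ ∃ u, Follows Ps (Sum.inl p) u := by
  rcases eq_or_exists_succ_of_mem hp with h | ⟨u, hu⟩
  · exact Or.inl ⟨l, hl, h⟩
  · exact Or.inr ⟨u, l, hl, hu⟩

theorem Feasible.notMem_sinkOf (h : Feasible E M S T Ps) {p : P} {w : P ⊕ F}
    (hw : Follows Ps (Sum.inl p) w) : p ∉ sinkOf Ps := by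
  rintro ⟨l, hl, hp⟩
  obtain ⟨l', hl', hm⟩ := hw
  obtain rfl := h.eq_of_mem hl hl' (List.mem_of_mem_getLast? hp) (mem_of_mem_zip_tail hm).1
  exact not_getLast_of_mem_zip_tail (h.1 l hl).2.2 hm hp

theorem Feasible.srcOf_subset (h : Feasible E M S T Ps) : srcOf Ps ⊆ S := by
  rintro p ⟨l, hl, hp⟩
  obtain ⟨q, hq, hq'⟩ := h.2.1 l hl
  obtain rfl : p = q := by simpa [hp] using hq'
  exact hq

theorem Feasible.sinkOf_subset (h : Feasible E M S T Ps) : sinkOf Ps ⊆ T := by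
  rintro p ⟨l, hl, hp⟩
  obtain ⟨q, hq, hq'⟩ := h.2.2.1 l hl
  obtain rfl : p = q := by simpa [hp] using hq'
  exact hq

theorem Feasible.exists_pred_resource (h : Feasible E M S T Ps) {p : P} {u : P ⊕ F}
    (hu : Follows Ps u (Sum.inl p)) : ∃ r, u = Sum.inr r ∧ (p, r) ∈ M := by
  have := h.dirAdj hu
  rcases u with q | r
  · exact this.elim
  · exact ⟨r, rfl, this⟩

theorem Feasible.exists_succ_resource (h : Feasible E M S T Ps) {p : P} {u : P ⊕ F}
    (hu : Follows Ps (Sum.inl p) u) : ∃ r, u = Sum.inr r ∧ E p r ∧ (p, r) ∉ M := by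
  have := h.dirAdj hu
  rcases u with q | r
  · exact this.elim
  · exact ⟨r, rfl, this⟩

theorem Feasible.exists_pred_player (h : Feasible E M S T Ps) {p : P} {r : F}
    (hr : Follows Ps (Sum.inr r) (Sum.inl p)) : ∃ q, Follows Ps (Sum.inl q) (Sum.inr r) := by
  obtain ⟨l, hl, hm⟩ := hr
  rcases eq_or_exists_pred_of_mem (mem_of_mem_zip_tail hm).1 with h' | ⟨u, hu⟩
  · obtain ⟨q, _, hq⟩ := h.2.1 l hl
    simp [hq] at h'
  · have := h.dirAdj ⟨l, hl, hu⟩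
    rcases u with q | s
    · exact ⟨q, l, hl, hu⟩
    · exact this.elim

theorem Feasible.exists_succ_player (h : Feasible E M S T Ps) {p : P} {r : F}
    (hr : Follows Ps (Sum.inl p) (Sum.inr r)) :
    ∃ q, Follows Ps (Sum.inr r) (Sum.inl q) ∧ (q, r) ∈ M := by
  obtain ⟨l, hl, hm⟩ := hr
  rcases eq_or_exists_succ_of_mem (mem_of_mem_zip_tail hm).2 with h' | ⟨u, hu⟩
  · obtain ⟨q, _, hq⟩ := h.2.2.1 l hl
    simp [hq] at h'
  · have := h.dirAdj ⟨l, hl, hu⟩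
    rcases u with q | s
    · exact ⟨q, ⟨l, hl, hu⟩, this⟩
    · exact this.elim

variable [Fintype P] [Fintype F] [DecidableEq P] [DecidableEq F]

theorem Feasible.mem_symmDiffMatch (h : Feasible E M S T Ps) {p : P} {r : F} :
    (p, r) ∈ symmDiffMatch M Ps ↔
      Follows Ps (Sum.inl p) (Sum.inr r) ∨
        ((p, r) ∈ M ∧ ¬ Follows Ps (Sum.inr r) (Sum.inl p)) := by
  have h₁ : Follows Ps (Sum.inl p) (Sum.inr r) → (p, r) ∉ M := fun hf => (h.dirAdj hf).2
  have h₂ : Follows Ps (Sum.inr r) (Sum.inl p) → (p, r) ∈ M := fun hf => h.dirAdj hf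
  have h₃ : (∃ l ∈ Ps, usesEdge l p r) ↔
      Follows Ps (Sum.inl p) (Sum.inr r) ∨ Follows Ps (Sum.inr r) (Sum.inl p) := by
    simp only [usesEdge, Follows, ← exists_or, and_or_left]
  simp only [symmDiffMatch, Finset.mem_filter, Finset.mem_univ, true_and, h₃]
  tauto

theorem Feasible.isMatching_symmDiffMatch (h : Feasible E M S T Ps) (hM : IsMatching E M)
    (hS : ∀ p ∈ S, ∀ r, (p, r) ∉ M) : IsMatching E (symmDiffMatch M Ps) := by
  have hp {p r r'} (hf : Follows Ps (Sum.inl p) (Sum.inr r)) (hm : (p, r') ∈ M)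
      (hn : ¬ Follows Ps (Sum.inr r') (Sum.inl p)) : False := by
    obtain ⟨l, hl, hz⟩ := id hf
    rcases srcOf_or_exists_follows hl (mem_of_mem_zip_tail hz).1 with hs | ⟨u, hu⟩
    · exact hS p (h.srcOf_subset hs) _ hm
    · obtain ⟨s, rfl, hs⟩ := h.exists_pred_resource hu
      obtain rfl : s = r' := congrArg Prod.snd (hM.2.1 _ hs _ hm rfl)
      exact hn hu
  have hr {p p' r} (hf : Follows Ps (Sum.inl p) (Sum.inr r)) (hm : (p', r) ∈ M)
      (hn : ¬ Follows Ps (Sum.inr r) (Sum.inl p')) : False := by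
    obtain ⟨q, hq, hqM⟩ := h.exists_succ_player hf
    obtain rfl : q = p' := congrArg Prod.fst (hM.2.2 _ hqM _ hm rfl)
    exact hn hq
  refine ⟨?_, ?_, ?_⟩
  · rintro ⟨p, r⟩ he
    rcases h.mem_symmDiffMatch.1 he with hf | ⟨hm, -⟩
    · exact (h.dirAdj hf).1
    · exact hM.1 _ hm
  · rintro ⟨p, r⟩ he ⟨p', r'⟩ he' (rfl : p = p')
    rcases h.mem_symmDiffMatch.1 he with hf | ⟨hm, hn⟩ <;>
      rcases h.mem_symmDiffMatch.1 he' with hf' | ⟨hm', hn'⟩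
    · rw [Sum.inr_injective (h.succ_unique hf hf')]
    · exact (hp hf hm' hn').elim
    · exact (hp hf' hm hn).elim
    · exact hM.2.1 _ hm _ hm' rfl
  · rintro ⟨p, r⟩ he ⟨p', r'⟩ he' (rfl : r = r')
    rcases h.mem_symmDiffMatch.1 he with hf | ⟨hm, hn⟩ <;>
      rcases h.mem_symmDiffMatch.1 he' with hf' | ⟨hm', hn'⟩
    · rw [Sum.inl_injective (h.pred_unique hf hf')]
    · exact (hr hf hm' hn').elim
    · exact (hr hf' hm hn).elim
    · exact hM.2.2 _ hm _ hm' rfl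

theorem Feasible.resource_matched_iff (h : Feasible E M S T Ps) (r : F) :
    (∃ p, (p, r) ∈ symmDiffMatch M Ps) ↔ ∃ p, (p, r) ∈ M := by
  constructor
  · rintro ⟨p, hp⟩
    rcases h.mem_symmDiffMatch.1 hp with hf | ⟨hm, -⟩
    · obtain ⟨q, -, hq⟩ := h.exists_succ_player hf
      exact ⟨q, hq⟩
    · exact ⟨p, hm⟩
  · rintro ⟨p, hp⟩
    by_cases hf : Follows Ps (Sum.inr r) (Sum.inl p)
    · obtain ⟨q, hq⟩ := h.exists_pred_player hf
      exact ⟨q, h.mem_symmDiffMatch.2 (Or.inl hq)⟩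
    · exact ⟨p, h.mem_symmDiffMatch.2 (Or.inr ⟨hp, hf⟩)⟩

theorem Feasible.player_matched_iff (h : Feasible E M S T Ps) (hM : IsMatching E M)
    (hS : ∀ p ∈ S, ∀ r, (p, r) ∉ M) (p : P) :
    (∃ r, (p, r) ∈ symmDiffMatch M Ps) ↔
      ((∃ r, (p, r) ∈ M) ∨ p ∈ srcOf Ps) ∧ p ∉ sinkOf Ps := by
  constructor
  · rintro ⟨r, hr⟩
    rcases h.mem_symmDiffMatch.1 hr with hf | ⟨hm, hn⟩
    · refine ⟨?_, h.notMem_sinkOf hf⟩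
      obtain ⟨l, hl, hz⟩ := hf
      rcases srcOf_or_exists_follows hl (mem_of_mem_zip_tail hz).1 with hs | ⟨u, hu⟩
      · exact Or.inr hs
      · obtain ⟨s, -, hs⟩ := h.exists_pred_resource hu
        exact Or.inl ⟨s, hs⟩
    · refine ⟨Or.inl ⟨r, hm⟩, ?_⟩
      rintro ⟨l, hl, hz⟩
      rcases srcOf_or_exists_follows hl (List.mem_of_mem_getLast? hz) with hs | ⟨u, hu⟩
      · exact hS p (h.srcOf_subset hs) _ hm
      · obtain ⟨s, rfl, hs⟩ := h.exists_pred_resource hu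
        obtain rfl : s = r := congrArg Prod.snd (hM.2.1 _ hs _ hm rfl)
        exact hn hu
  · rintro ⟨hp, hsink⟩
    by_cases hl : ∃ l ∈ Ps, Sum.inl p ∈ l
    · obtain ⟨l, hl, hpl⟩ := hl
      obtain ⟨u, hu⟩ := (sinkOf_or_exists_follows hl hpl).resolve_left hsink
      obtain ⟨r, rfl, -⟩ := h.exists_succ_resource hu
      exact ⟨r, h.mem_symmDiffMatch.2 (Or.inl hu)⟩
    · rcases hp with ⟨r, hr⟩ | ⟨l, hl', hp⟩
      · refine ⟨r, h.mem_symmDiffMatch.2 (Or.inr ⟨hr, ?_⟩)⟩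
        rintro ⟨l, hl', hz⟩
        exact hl ⟨l, hl', (mem_of_mem_zip_tail hz).2⟩
      · exact (hl ⟨l, hl', List.mem_of_mem_head? hp⟩).elim

theorem Feasible.isMaxMatching_symmDiffMatch (h : Feasible E M S T Ps)
    (hM : IsMaxMatching E M) (hS : ∀ p ∈ S, ∀ r, (p, r) ∉ M) :
    IsMaxMatching E (symmDiffMatch M Ps) :=
  ⟨h.isMatching_symmDiffMatch hM.1 hS, fun M' hM' => (hM.2 M' hM').trans
    (card_le_card_of_resource_matched hM.1 fun r => (h.resource_matched_iff r).2)⟩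

end Flip

section Optimality

variable {P F : Type*} {E : P → F → Prop} {M : Finset (P × F)} {S T : Set P}
  {Ps : Finset (List (P ⊕ F))}

theorem Feasible.mono (h : Feasible E M S T Ps) {S' T' : Set P} (hS : S ⊆ S') (hT : T ⊆ T') :
    Feasible E M S' T' Ps := by
  refine ⟨h.1, fun l hl => ?_, fun l hl => ?_, h.2.2.2⟩
  · obtain ⟨p, hp, hp'⟩ := h.2.1 l hl
    exact ⟨p, hS hp, hp'⟩
  · obtain ⟨p, hp, hp'⟩ := h.2.2.1 l hl
    exact ⟨p, hT hp, hp'⟩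

theorem Feasible.ncard_srcOf (h : Feasible E M S T Ps) : (srcOf Ps).ncard = Ps.card := by
  have hhead : ∀ l ∈ Ps, ∃ p : P, l.head? = some (Sum.inl p) := fun l hl => by
    obtain ⟨p, -, hp⟩ := h.2.1 l hl
    exact ⟨p, hp⟩
  choose f hf using hhead
  rw [← Set.ncard_coe_finset]
  symm
  refine Set.ncard_congr (fun l hl => f l hl) (fun l hl => ⟨l, hl, hf l hl⟩) ?_ ?_
  · intro l l' hl hl' hll
    exact h.eq_of_mem hl hl' (List.mem_of_mem_head? (hf l hl))
      (hll ▸ List.mem_of_mem_head? (hf l' hl'))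
  · rintro p ⟨l, hl, hp⟩
    exact ⟨l, hl, Sum.inl_injective (Option.some_injective _ ((hf l hl).symm.trans hp))⟩

variable [Fintype P]

theorem bddAbove_feasible_card :
    BddAbove {n | ∃ Ps : Finset (List (P ⊕ F)), Feasible E M S T Ps ∧ Ps.card = n} := by
  refine ⟨Fintype.card P, ?_⟩
  rintro n ⟨Ps, h, rfl⟩
  rw [← h.ncard_srcOf, ← Nat.card_eq_fintype_card]
  exact Set.ncard_le_card _

theorem Feasible.card_le_fM (h : Feasible E M S T Ps) : Ps.card ≤ fM E M S T :=
  le_csSup bddAbove_feasible_card ⟨Ps, h, rfl⟩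

theorem Feasible.exists_card_eq_fM (h : Feasible E M S T Ps) :
    ∃ Qs : Finset (List (P ⊕ F)), Feasible E M S T Qs ∧ Qs.card = fM E M S T :=
  Nat.sSup_mem (s := {n | ∃ Qs : Finset (List (P ⊕ F)), Feasible E M S T Qs ∧ Qs.card = n})
    ⟨_, Ps, h, rfl⟩ bddAbove_feasible_card

variable [Fintype F] [DecidableEq P] [DecidableEq F]

/-- A path from an unused source to an unused sink in the flipped graph can be used to enlarge a
feasible solution. -/
theorem Feasible.exists_card_eq_succ (h : Feasible E M S T Ps) (hM : IsMatching E M)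
    (hS : ∀ p ∈ S, ∀ r, (p, r) ∉ M) {l : List (P ⊕ F)}
    (hl : IsDirPath (DirAdj E (symmDiffMatch M Ps)) l) (hs : startsIn (S \ srcOf Ps) l)
    (ht : endsIn (T \ sinkOf Ps) l) :
    ∃ Qs : Finset (List (P ⊕ F)), Feasible E M S T Qs ∧ Qs.card = Ps.card + 1 := by
  classical
  obtain ⟨s, ⟨hsS, hsP⟩, hhead⟩ := hs
  obtain ⟨t, ⟨htT, -⟩, hlast⟩ := ht
  have hM' := h.isMatching_symmDiffMatch hM hS
  have h' : Feasible E (symmDiffMatch M Ps) {s} {t} {l} :=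
    ⟨by simpa using hl, by simpa [startsIn] using hhead, by simpa [endsIn] using hlast,
      by simp +contextual⟩
  have hs' : ∀ p ∈ ({s} : Set P), ∀ r, (p, r) ∉ symmDiffMatch M Ps := by
    rintro p rfl r hr
    rcases ((h.player_matched_iff hM hS p).1 ⟨r, hr⟩).1 with ⟨r', hr'⟩ | hp
    · exact hS p hsS r' hr'
    · exact hsP hp
  have hmatched {p : P} (hp : (∃ r, (p, r) ∈ M) ∨ p ∈ insert s (srcOf Ps)) :
      p ∈ insert t (sinkOf Ps) ∨ ∃ r, (p, r) ∈ symmDiffMatch (symmDiffMatch M Ps) {l} := by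
    rw [h'.player_matched_iff hM' hs', h.player_matched_iff hM hS]
    have hsrc : p ∈ srcOf {l} ↔ p = s := by
      simp [srcOf, hhead, eq_comm]
    have hsink : p ∈ sinkOf {l} ↔ p = t := by
      simp [sinkOf, hlast, eq_comm]
    rw [hsrc, hsink]
    simp only [Set.mem_insert_iff] at hp ⊢
    tauto
  obtain ⟨Qs, hQs, hcard⟩ := exists_feasible_card_eq hM (h'.isMatching_symmDiffMatch hM' hs')
    (fun r hr => (h.resource_matched_iff r).1 ((h'.resource_matched_iff r).1 hr))
    (insert s (srcOf Ps)).toFinset (Y := insert t (sinkOf Ps))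
    (fun p hp => hS p (Set.insert_subset hsS h.srcOf_subset (Set.mem_toFinset.1 hp)))
    (fun p hp => hmatched (Or.inr (Set.mem_toFinset.1 hp)))
    (fun p r hp => hmatched (Or.inl ⟨r, hp⟩))
  refine ⟨Qs, hQs.mono ?_ (Set.insert_subset htT h.sinkOf_subset), ?_⟩
  · rw [Set.coe_toFinset]
    exact Set.insert_subset hsS h.srcOf_subset
  · rw [hcard, ← Set.ncard_eq_toFinset_card', Set.ncard_insert_of_notMem hsP, h.ncard_srcOf]

/-- A feasible solution admitting no path from an unused source to an unused sink in the flipped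
graph is at least as large as any other one. -/
theorem Feasible.card_le_of_not_exists_path (h : Feasible E M S T Ps) (hM : IsMatching E M)
    (hS : ∀ p ∈ S, ∀ r, (p, r) ∉ M)
    (hno : ¬ ∃ l : List (P ⊕ F), IsDirPath (DirAdj E (symmDiffMatch M Ps)) l ∧
      startsIn (S \ srcOf Ps) l ∧ endsIn (T \ sinkOf Ps) l)
    {Qs : Finset (List (P ⊕ F))} (hQs : Feasible E M S T Qs) : Qs.card ≤ Ps.card := by
  classical
  have hM' := h.isMatching_symmDiffMatch hM hS
  have hN := hQs.isMatching_symmDiffMatch hM hS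
  let A : Finset P := (srcOf Qs \ srcOf Ps).toFinset
  let B : Finset P := (srcOf Ps \ srcOf Qs).toFinset
  let R : Finset P := Finset.univ.filter fun p => ∃ a ∈ A,
    Relation.ReflTransGen (DirAdj E (symmDiffMatch M Ps)) (Sum.inl a) (Sum.inl p)
  have hR {p} : p ∈ R ↔ ∃ a ∈ A,
      Relation.ReflTransGen (DirAdj E (symmDiffMatch M Ps)) (Sum.inl a) (Sum.inl p) := by
    simp [R]
  have hA {p} : p ∈ A ↔ p ∈ srcOf Qs ∧ p ∉ srcOf Ps := by simp [A]
  have hB {p} : p ∈ B ↔ p ∈ srcOf Ps ∧ p ∉ srcOf Qs := by simp [B]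
  have hsink {p} (hp : p ∈ R) (hpT : p ∈ T) : p ∈ sinkOf Ps := by
    by_contra hpP
    obtain ⟨a, ha, hap⟩ := hR.1 hp
    obtain ⟨l, hl, hh, ht⟩ := exists_isDirPath_of_reflTransGen hap
    exact hno ⟨l, hl, ⟨a, ⟨hQs.srcOf_subset (hA.1 ha).1, (hA.1 ha).2⟩, hh⟩, p, ⟨hpT, hpP⟩, ht⟩
  have hAB : A.card ≤ B.card := by
    refine card_le_card_unmatched_of_closed (R := R) hM' hN
      (fun r hr => (h.resource_matched_iff r).2 ((hQs.resource_matched_iff r).1 hr)) ?_ ?_ ?_ ?_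
    · intro p hp r hr
      have := (h.player_matched_iff hM hS p).1 ⟨r, hr⟩
      rcases this.1 with ⟨r', hr'⟩ | hp'
      · exact hS p (hQs.srcOf_subset (hA.1 hp).1) r' hr'
      · exact (hA.1 hp).2 hp'
    · exact fun p hp => hR.2 ⟨p, hp, .refl⟩
    · intro p hp q r hpr hqr
      by_cases hpq : p = q
      · exact hpq ▸ hp
      · obtain ⟨a, ha, hap⟩ := hR.1 hp
        have hp' : DirAdj E (symmDiffMatch M Ps) (Sum.inl p) (Sum.inr r) :=
          ⟨hN.1 _ hpr, fun hm => hpq (congrArg Prod.fst (hM'.2.2 _ hm _ hqr rfl))⟩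
        exact hR.2 ⟨a, ha, (hap.tail hp').tail hqr⟩
    · intro p hp hn
      have hn' : ¬ (((∃ r, (p, r) ∈ M) ∨ p ∈ srcOf Qs) ∧ p ∉ sinkOf Qs) := by
        rw [← hQs.player_matched_iff hM hS]
        exact fun ⟨r, hr⟩ => hn r hr
      have hcase : p ∈ srcOf Qs ∧ (∀ r, (p, r) ∉ M) ∧ p ∉ srcOf Ps ∨
          ((∃ r, (p, r) ∈ M) ∨ p ∈ srcOf Ps) ∧ p ∉ sinkOf Ps := by
        obtain ⟨a, ha, hap⟩ := hR.1 hp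
        rcases hap.cases_tail with heq | ⟨u, -, hu⟩
        · obtain rfl := Sum.inl_injective heq
          exact Or.inl ⟨(hA.1 ha).1, hS p (hQs.srcOf_subset (hA.1 ha).1), (hA.1 ha).2⟩
        · rcases u with q | r
          · exact hu.elim
          · exact Or.inr ((h.player_matched_iff hM hS p).1 ⟨r, hu⟩)
      have hQP : p ∈ sinkOf Qs → p ∈ sinkOf Ps := fun hq => hsink hp (hQs.sinkOf_subset hq)
      rw [hB]
      rcases hcase with ⟨hq, hpM, hpP⟩ | hcase
      · have hpsink : p ∈ sinkOf Ps := by tauto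
        obtain ⟨l, hl, hz⟩ := hpsink
        rcases srcOf_or_exists_follows hl (List.mem_of_mem_getLast? hz) with hs | ⟨u, hu⟩
        · exact (hpP hs).elim
        · obtain ⟨r, -, hr⟩ := h.exists_pred_resource hu
          exact (hpM r hr).elim
      · tauto
  rw [← h.ncard_srcOf, ← hQs.ncard_srcOf]
  simp only [A, B, ← Set.ncard_eq_toFinset_card'] at hAB
  exact (Set.ncard_le_ncard_iff_ncard_sdiff_le_ncard_sdiff (Set.toFinite _)
    (Set.toFinite _)).2 hAB

end Optimality

/-- **Optimality criterion for node-disjoint path packings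
(Lemma on `G_M(S,T)`).**  Let `M` be a maximum matching of the bipartite
graph `G`, `S` a set of players unmatched by `M`, `T` a set of players, and
`Ps` a feasible solution for `G_M(S,T)`.  Then `M ⊕ Ps` is a maximum matching
of `G`, and `Ps` is optimal (i.e. `|Ps| = f_M(S,T)`) if and only if there is
no directed path in `G_{M ⊕ Ps}` from a vertex of `S ∖ src_Ps` to a vertex of
`T ∖ sink_Ps`. -/
theorem flip_max_and_optimality_iff
    {P F : Type*} [Fintype P] [Fintype F] [DecidableEq P] [DecidableEq F]
    (E : P → F → Prop) (M : Finset (P × F)) (hM : IsMaxMatching E M)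
    (S T : Set P) (hS : ∀ p ∈ S, ∀ r, (p, r) ∉ M)
    (Ps : Finset (List (P ⊕ F))) (hPs : Feasible E M S T Ps) :
    IsMaxMatching E (symmDiffMatch M Ps) ∧
    (Ps.card = fM E M S T ↔
      ¬ ∃ l : List (P ⊕ F), IsDirPath (DirAdj E (symmDiffMatch M Ps)) l ∧
        startsIn (S \ srcOf Ps) l ∧ endsIn (T \ sinkOf Ps) l) := by
  refine ⟨hPs.isMaxMatching_symmDiffMatch hM hS, ?_, fun hno => ?_⟩
  · rintro hopt ⟨l, hl, hs, ht⟩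
    obtain ⟨Qs, hQs, hcard⟩ := hPs.exists_card_eq_succ hM.1 hS hl hs ht
    have := hQs.card_le_fM
    omega
  · obtain ⟨Qs, hQs, hcard⟩ := hPs.exists_card_eq_fM
    exact le_antisymm hPs.card_le_fM (hcard ▸ hPs.card_le_of_not_exists_path hM.1 hS hno hQs)
end
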